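/- Parity–conjugation invariance of the von Neumann Hermite–Galerkin system (core of Proposition 4.2 (i)): let V : ℝ → ℝ be smooth with all derivatives of order ≥ 2 bounded, let ħ > 0 and N ∈ ℕ, and let (R_k)_{k=0}^N be a strong solution of the von Neumann Hermite–Galerkin system of size N. Then the family (S_k)_{k=0}^N defined by S_k(t,x) := (−1)^k · conj(R_k(t,x)) is also a strong solution of the same system. -/

import Mathlib

open MeasureTheory

noncomputable section

/-- Mixed partial derivative `∂_x^b ∂_y^β` of a function `f(x,y)`. -/
def pd2 (b β : ℕ) (f : ℝ → ℝ → ℂ) (x y : ℝ) : ℂ :=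
  iteratedDeriv b (fun x' => iteratedDeriv β (fun y' => f x' y') y) x

/-- Weighted derivative `x^a ∂_x^b y^α ∂_y^β` of `f(x,y)`. -/
def wD (a b α β : ℕ) (f : ℝ → ℝ → ℂ) (x y : ℝ) : ℂ :=
  (x : ℂ) ^ a * (y : ℂ) ^ α * pd2 b β f x y

/-- Uncurried version of a two-variable function. -/
def unc (f : ℝ → ℝ → ℂ) : ℝ × ℝ → ℂ := fun p => f p.1 p.2

/-- L² norm over ℝ². -/
def L2 (f : ℝ → ℝ → ℂ) : ℝ := (eLpNorm (unc f) 2 (volume : Measure (ℝ × ℝ))).toReal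

/-- L² norm over ℝ. -/
def L2one (f : ℝ → ℂ) : ℝ := (eLpNorm f 2 (volume : Measure ℝ)).toReal

/-- Schwartz-class predicate for smooth functions of two real variables. -/
def IsSchwartz2 (f : ℝ → ℝ → ℂ) : Prop :=
  ContDiff ℝ (⊤ : ℕ∞) (unc f) ∧
    ∀ k n : ℕ, ∃ C : ℝ, ∀ p : ℝ × ℝ, ‖p‖ ^ k * ‖iteratedFDeriv ℝ n (unc f) p‖ ≤ C

/-- Schwartz-class predicate for smooth functions of one real variable. -/
def IsSchwartz1 (f : ℝ → ℂ) : Prop :=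
  ContDiff ℝ (⊤ : ℕ∞) f ∧ ∀ k n : ℕ, ∃ C : ℝ, ∀ x : ℝ, |x| ^ k * ‖iteratedDeriv n f x‖ ≤ C

/-- Time derivative of a time-dependent two-variable function. -/
def dtR (R : ℝ → ℝ → ℝ → ℂ) (t x y : ℝ) : ℂ := deriv (fun s => R s x y) t

/-- For all `a b α β`, the map `t ↦ x^a ∂_x^b y^α ∂_y^β R(t,·,·)` is continuously
differentiable from `[0,∞)` into `L²(ℝ²)` with derivative `x^a ∂_x^b y^α ∂_y^β ∂_t R(t,·,·)`. -/
def C1intoL2 (R : ℝ → ℝ → ℝ → ℂ) : Prop :=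
  ∀ a b α β : ℕ, ∃ Ψ Ψ' : ℝ → Lp ℂ 2 (volume : Measure (ℝ × ℝ)),
    (∀ t : ℝ, 0 ≤ t → (Ψ t : ℝ × ℝ → ℂ) =ᵐ[volume] unc (wD a b α β (R t))) ∧
    (∀ t : ℝ, 0 ≤ t → (Ψ' t : ℝ × ℝ → ℂ) =ᵐ[volume] unc (wD a b α β (dtR R t))) ∧
    (∀ t : ℝ, 0 ≤ t → HasDerivWithinAt Ψ (Ψ' t) (Set.Ici 0) t) ∧
    ContinuousOn Ψ' (Set.Ici 0)

/-- Regularity part of the notion of strong solution on `[0,∞) × ℝ²`. -/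
def IsRegularSol (R : ℝ → ℝ → ℝ → ℂ) : Prop :=
  ContDiffOn ℝ (⊤ : ℕ∞) (fun p : ℝ × ℝ × ℝ => R p.1 p.2.1 p.2.2) {p : ℝ × ℝ × ℝ | 0 ≤ p.1} ∧
  (∀ t : ℝ, 0 ≤ t → IsSchwartz2 (R t)) ∧ C1intoL2 R

/-- Strong solution of the von Neumann equation in Weyl variables. -/
def IsVNSol (hbar : ℝ) (V : ℝ → ℝ) (R : ℝ → ℝ → ℝ → ℂ) : Prop :=
  IsRegularSol R ∧
  ∀ t : ℝ, 0 ≤ t → ∀ x y : ℝ,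
    dtR R t x y = Complex.I * pd2 1 1 (R t) x y -
      Complex.I * (((V (x + hbar * y / 2) - V (x - hbar * y / 2)) / hbar : ℝ) : ℂ) * R t x y

/-- Strong solution of the semiclassical equation. -/
def IsSCSol (V : ℝ → ℝ) (R : ℝ → ℝ → ℝ → ℂ) : Prop :=
  IsRegularSol R ∧
  ∀ t : ℝ, 0 ≤ t → ∀ x y : ℝ,
    dtR R t x y = Complex.I * pd2 1 1 (R t) x y -
      Complex.I * ((deriv V x * y : ℝ) : ℂ) * R t x y

/-- The weighted Sobolev functional `𝒩_m` applied to a function of `(x,y)`. -/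
def NN (m : ℕ) (f : ℝ → ℝ → ℂ) : ℝ :=
  ∑ q ∈ Finset.filter
      (fun q : ℕ × ℕ × ℕ × ℕ => q.1 + q.2.1 + q.2.2.1 + q.2.2.2 ≤ m)
      (Finset.range (m+1) ×ˢ Finset.range (m+1) ×ˢ Finset.range (m+1) ×ˢ Finset.range (m+1)),
    L2 (wD q.1 q.2.1 q.2.2.1 q.2.2.2 f)

/-- Supremum norm of a real-valued function. -/
def supN (f : ℝ → ℝ) : ℝ := ⨆ x : ℝ, |f x|

/-- The constant `C_m[V]`. -/
def CmV (m : ℕ) (V : ℝ → ℝ) : ℝ :=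
  ((m : ℝ)^2 + 2*m + m * supN (iteratedDeriv 2 V) + m * |deriv V 0|) +
    2^m * (1+m) * m * (⨆ n ∈ Finset.Icc 2 (m+1), supN (iteratedDeriv n V))

/-- Physicists' Hermite polynomial. -/
def Hpoly (k : ℕ) (y : ℝ) : ℝ :=
  (-1)^k * Real.exp (y^2) * iteratedDeriv k (fun z => Real.exp (-z^2)) y

/-- Hermite function `Φ_k`. -/
def Φh (k : ℕ) (y : ℝ) : ℝ :=
  ((2:ℝ)^k * (Nat.factorial k : ℝ) * Real.sqrt Real.pi) ^ (-(1:ℝ)/2) *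
    Real.exp (-y^2/2) * Hpoly k y

/-- The operator `𝒟 u = ∂_x u + V'(x) u`. -/
def Dop (V : ℝ → ℝ) (u : ℝ → ℂ) (x : ℝ) : ℂ := deriv u x + ((deriv V x : ℝ) : ℂ) * u x

/-- The operator `𝒟* u = −∂_x u + V'(x) u`. -/
def Dstar (V : ℝ → ℝ) (u : ℝ → ℂ) (x : ℝ) : ℂ := -deriv u x + ((deriv V x : ℝ) : ℂ) * u x

/-- The quantum correction `ℰ^ħ(x,y)`. -/
def Eh (hbar : ℝ) (V : ℝ → ℝ) (x y : ℝ) : ℝ :=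
  (V (x + hbar * y / 2) - V (x - hbar * y / 2)) / hbar - deriv V x * y

/-- Matrix elements `ℰ^ħ_{k,l}(x)` of the quantum correction. -/
def Ekl (hbar : ℝ) (V : ℝ → ℝ) (k l : ℕ) (x : ℝ) : ℝ :=
  ∫ y : ℝ, Eh hbar V x y * Φh k y * Φh l y

/-- `t ↦ u(t,·)` is continuously differentiable from `[0,∞)` into `L²(ℝ)` with
derivative `∂_t u`. -/
def C1intoL2one (u : ℝ → ℝ → ℂ) : Prop :=
  ∃ Ψ Ψ' : ℝ → Lp ℂ 2 (volume : Measure ℝ),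
    (∀ t : ℝ, 0 ≤ t → (Ψ t : ℝ → ℂ) =ᵐ[volume] u t) ∧
    (∀ t : ℝ, 0 ≤ t → (Ψ' t : ℝ → ℂ) =ᵐ[volume] fun x => deriv (fun s => u s x) t) ∧
    (∀ t : ℝ, 0 ≤ t → HasDerivWithinAt Ψ (Ψ' t) (Set.Ici 0) t) ∧
    ContinuousOn Ψ' (Set.Ici 0)

/-- Regularity part of the notion of strong solution of a Hermite–Galerkin system of size `N`;
the convention `R_k = 0` for `k > N` is included. -/
def IsGalerkinReg (N : ℕ) (R : ℕ → ℝ → ℝ → ℂ) : Prop :=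
  (∀ k, k ≤ N → ContDiffOn ℝ (⊤ : ℕ∞) (fun p : ℝ × ℝ => R k p.1 p.2) {p : ℝ × ℝ | 0 ≤ p.1}) ∧
  (∀ k, k ≤ N → ∀ t : ℝ, 0 ≤ t → IsSchwartz1 (R k t)) ∧
  (∀ k, k ≤ N → C1intoL2one (R k)) ∧
  (∀ k, N < k → ∀ t x : ℝ, R k t x = 0)

/-- Strong solution of the semiclassical Hermite–Galerkin system of size `N`.
(For `k = 0` the coefficient `√(k/2)` vanishes, so the term `R_{k-1}` is harmless.) -/
def IsSCGalerkinSol (V : ℝ → ℝ) (N : ℕ) (R : ℕ → ℝ → ℝ → ℂ) : Prop :=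
  IsGalerkinReg N R ∧
  ∀ k, k ≤ N → ∀ t : ℝ, 0 ≤ t → ∀ x : ℝ,
    deriv (fun s => R k s x) t +
      Complex.I * ((Real.sqrt ((k : ℝ)/2) : ℂ) * Dop V (R (k-1) t) x +
        (Real.sqrt (((k : ℝ)+1)/2) : ℂ) * Dstar V (R (k+1) t) x) = 0

/-- Strong solution of the von Neumann Hermite–Galerkin system of size `N`. -/
def IsVNGalerkinSol (hbar : ℝ) (V : ℝ → ℝ) (N : ℕ) (R : ℕ → ℝ → ℝ → ℂ) : Prop :=
  IsGalerkinReg N R ∧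
  ∀ k, k ≤ N → ∀ t : ℝ, 0 ≤ t → ∀ x : ℝ,
    deriv (fun s => R k s x) t +
      Complex.I * ((Real.sqrt ((k : ℝ)/2) : ℂ) * Dop V (R (k-1) t) x +
        (Real.sqrt (((k : ℝ)+1)/2) : ℂ) * Dstar V (R (k+1) t) x) =
      -Complex.I * ∑ l ∈ Finset.range (N+1), ((Ekl hbar V k l x : ℝ) : ℂ) * R l t x

/-- Smooth potential with all derivatives of order `≥ 2` bounded. -/
def SmoothBounded (V : ℝ → ℝ) : Prop :=
  ContDiff ℝ (⊤ : ℕ∞) V ∧ ∀ n : ℕ, 2 ≤ n → ∃ C : ℝ, ∀ x : ℝ, |iteratedDeriv n V x| ≤ C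

/-- The harmonic-oscillator operator `A G = y² G − G''`. -/
def Aop (g : ℝ → ℂ) : ℝ → ℂ := fun y => (y : ℂ)^2 * g y - iteratedDeriv 2 g y

/-- The real-linear isometry `z ↦ (-1)^k * conj z` of `ℂ`. -/
def signedConj (k : ℕ) : ℂ ≃ₗᵢ[ℝ] ℂ :=
  if Even k then Complex.conjLIE else Complex.conjLIE.trans (LinearIsometryEquiv.neg ℝ)

theorem signedConj_apply (k : ℕ) (z : ℂ) : signedConj k z = (-1) ^ k * (starRingEnd ℂ) z := by
  unfold signedConj
  split_ifs with h
  · simp [h.neg_one_pow]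
  · simp [(Nat.not_even_iff_odd.mp h).neg_one_pow]

theorem LinearIsometryEquiv.deriv_comp_left {E F : Type*} [NormedAddCommGroup E] [NormedSpace ℝ E]
    [NormedAddCommGroup F] [NormedSpace ℝ F] (L : E ≃ₗᵢ[ℝ] F) (f : ℝ → E) (x : ℝ) :
    deriv (fun y => L (f y)) x = L (deriv f x) := by
  have h := L.toContinuousLinearEquiv.comp_fderiv (f := f) (x := x)
  have h' := congrArg (fun A => A 1) h
  simpa [Function.comp_def] using h'

theorem IsSchwartz1.linearIsometryEquiv_comp {f : ℝ → ℂ} (hf : IsSchwartz1 f)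
    (L : ℂ ≃ₗᵢ[ℝ] ℂ) : IsSchwartz1 (fun x => L (f x)) := by
  refine ⟨L.contDiff.comp hf.1, fun k n => ?_⟩
  obtain ⟨C, hC⟩ := hf.2 k n
  refine ⟨C, fun x => ?_⟩
  have h : ‖iteratedDeriv n (fun x => L (f x)) x‖ = ‖iteratedDeriv n f x‖ := by
    rw [← norm_iteratedFDeriv_eq_norm_iteratedDeriv, ← norm_iteratedFDeriv_eq_norm_iteratedDeriv]
    exact L.norm_iteratedFDeriv_comp_left f x n
  rw [h]
  exact hC x

theorem C1intoL2one.linearIsometryEquiv_comp {u : ℝ → ℝ → ℂ} (hu : C1intoL2one u)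
    (L : ℂ ≃ₗᵢ[ℝ] ℂ) : C1intoL2one (fun t x => L (u t x)) := by
  obtain ⟨Ψ, Ψ', h, h', hd, hc⟩ := hu
  let A : ℂ →L[ℝ] ℂ := (L.toContinuousLinearEquiv : ℂ →L[ℝ] ℂ)
  let T := A.compLpL 2 (volume : Measure ℝ)
  refine ⟨fun t => T (Ψ t), fun t => T (Ψ' t), fun t ht => ?_, fun t ht => ?_, fun t ht => ?_,
    T.continuous.comp_continuousOn hc⟩
  · filter_upwards [A.coeFn_compLpL (Ψ t), h t ht] with x hx hx'
    rw [hx, hx']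
    rfl
  · filter_upwards [A.coeFn_compLpL (Ψ' t), h' t ht] with x hx hx'
    rw [hx, hx', L.deriv_comp_left]
    rfl
  · exact T.hasFDerivAt.comp_hasDerivWithinAt t (hd t ht)

theorem Hpoly_neg (k : ℕ) (y : ℝ) : Hpoly k (-y) = (-1) ^ k * Hpoly k y := by
  have h := iteratedDeriv_comp_neg k (fun z : ℝ => Real.exp (-z ^ 2)) (-y)
  simp only [neg_sq, neg_neg, smul_eq_mul] at h
  simp only [Hpoly, neg_sq, h]
  ring

theorem Φh_neg (k : ℕ) (y : ℝ) : Φh k (-y) = (-1) ^ k * Φh k y := by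
  simp only [Φh, Hpoly_neg, neg_sq]
  ring

theorem Eh_neg (hbar : ℝ) (V : ℝ → ℝ) (x y : ℝ) : Eh hbar V x (-y) = -Eh hbar V x y := by
  have h₁ : x + hbar * -y / 2 = x - hbar * y / 2 := by ring
  have h₂ : x - hbar * -y / 2 = x + hbar * y / 2 := by ring
  simp only [Eh, h₁, h₂]
  ring

theorem neg_one_pow_mul_Ekl (hbar : ℝ) (V : ℝ → ℝ) (k l : ℕ) (x : ℝ) :
    (-1) ^ k * Ekl hbar V k l x = -((-1) ^ l * Ekl hbar V k l x) := by
  have h : Ekl hbar V k l x = -((-1) ^ k * (-1) ^ l) * Ekl hbar V k l x := by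
    conv_lhs => rw [Ekl, ← integral_neg_eq_self]
    rw [Ekl, ← integral_const_mul]
    congr 1 with y
    rw [Eh_neg, Φh_neg, Φh_neg]
    ring
  have hk : ((-1 : ℝ) ^ k) * (-1) ^ k = 1 := by rw [← mul_pow]; simp
  linear_combination (-1) ^ k * h - (-1) ^ l * Ekl hbar V k l x * hk

theorem Dop_signedConj (V : ℝ → ℝ) (k : ℕ) (u : ℝ → ℂ) (x : ℝ) :
    Dop V (fun y => (-1) ^ k * (starRingEnd ℂ) (u y)) x =
      (-1) ^ k * (starRingEnd ℂ) (Dop V u x) := by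
  simp only [Dop, ← signedConj_apply, LinearIsometryEquiv.deriv_comp_left, map_add]
  simp only [signedConj_apply, map_mul, Complex.conj_ofReal]
  ring

theorem Dstar_signedConj (V : ℝ → ℝ) (k : ℕ) (u : ℝ → ℂ) (x : ℝ) :
    Dstar V (fun y => (-1) ^ k * (starRingEnd ℂ) (u y)) x =
      (-1) ^ k * (starRingEnd ℂ) (Dstar V u x) := by
  simp only [Dstar, ← signedConj_apply, LinearIsometryEquiv.deriv_comp_left, map_add, map_neg]
  simp only [signedConj_apply, map_mul, Complex.conj_ofReal]
  ring

theorem IsGalerkinReg.parity_conjugation {N : ℕ} {R : ℕ → ℝ → ℝ → ℂ} (hR : IsGalerkinReg N R) :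
    IsGalerkinReg N (fun k t x => (-1) ^ k * (starRingEnd ℂ) (R k t x)) := by
  simp only [← signedConj_apply]
  obtain ⟨h₁, h₂, h₃, h₄⟩ := hR
  refine ⟨fun k hk => (signedConj k).contDiff.comp_contDiffOn (h₁ k hk),
    fun k hk t ht => (h₂ k hk t ht).linearIsometryEquiv_comp _,
    fun k hk => (h₃ k hk).linearIsometryEquiv_comp _, fun k hk t x => ?_⟩
  simp only [h₄ k hk t x, map_zero]

/-- Parity–conjugation invariance of the von Neumann Hermite–Galerkin system
(core of Proposition 4.2 (i)). -/
theorem vonNeumann_galerkin_parity_conjugation (V : ℝ → ℝ) (hV : SmoothBounded V)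
    (hbar : ℝ) (hh : 0 < hbar) (N : ℕ) (R : ℕ → ℝ → ℝ → ℂ)
    (hR : IsVNGalerkinSol hbar V N R) :
    IsVNGalerkinSol hbar V N (fun k t x => (-1)^k * (starRingEnd ℂ) (R k t x)) := by
  refine ⟨hR.1.parity_conjugation, fun k hk t ht x => ?_⟩
  have h := congrArg (fun z => (-1) ^ k * (starRingEnd ℂ) z) (hR.2 k hk t ht x)
  have hd : deriv (fun s => (-1) ^ k * (starRingEnd ℂ) (R k s x)) t =
      (-1) ^ k * (starRingEnd ℂ) (deriv (fun s => R k s x) t) := by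
    simp only [← signedConj_apply, LinearIsometryEquiv.deriv_comp_left]
  have hlow : (Real.sqrt ((k : ℝ) / 2) : ℂ) * (-1) ^ (k - 1) =
      -((Real.sqrt ((k : ℝ) / 2) : ℂ) * (-1) ^ k) := by
    cases k with
    | zero => simp
    | succ n => simp [pow_succ]
  have hsum : ∑ l ∈ Finset.range (N + 1),
        ((Ekl hbar V k l x : ℝ) : ℂ) * ((-1) ^ l * (starRingEnd ℂ) (R l t x)) =
      -((-1) ^ k * ∑ l ∈ Finset.range (N + 1),
        ((Ekl hbar V k l x : ℝ) : ℂ) * (starRingEnd ℂ) (R l t x)) := by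
    rw [Finset.mul_sum, ← Finset.sum_neg_distrib]
    refine Finset.sum_congr rfl fun l _ => ?_
    have hE := congrArg (fun r : ℝ => (r : ℂ)) (neg_one_pow_mul_Ekl hbar V k l x)
    push_cast at hE
    linear_combination (starRingEnd ℂ) (R l t x) * hE
  simp only [map_add, map_mul, map_neg, map_sum, Complex.conj_I, Complex.conj_ofReal] at h
  simp only [hd, Dop_signedConj, Dstar_signedConj, hsum]
  linear_combination h + Complex.I * (starRingEnd ℂ) (Dop V (R (k - 1) t) x) * hlow

end
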